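/- Assume q_0 has finite fourth moment. Then for every t > 0 and every x ∈ ℝ^d, ∂_t ∇_x log q_t(x) = − ((λ_t + λ_t³)/σ_t⁴) m(t, x) + (2 λ_t²/σ_t⁴) x + (λ_t/σ_t²) E_{t,x}[ (θ − m(t, x)) f_0(θ, x, t) ], where f_0(θ, x, t) = (λ_t²/σ_t⁴) ‖θ‖₂² − ((λ_t + λ_t³)/σ_t⁴) ⟨x, θ⟩. -/

import Mathlib

open MeasureTheory ProbabilityTheory Real
open scoped RealInnerProductSpace

noncomputable section

abbrev Vec (d : ℕ) := EuclideanSpace ℝ (Fin d)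

def stdGaussian (d : ℕ) : Measure (Vec d) :=
  Measure.map (⇑(EuclideanSpace.equiv (Fin d) ℝ).symm)
    (Measure.pi fun _ : Fin d => gaussianReal 0 1)

/-- The law `q_u` of `e^{-u} θ + √(1 - e^{-2u}) g`, with `θ ~ q0` and `g ~ N(0, I_d)`
independent. -/
def forwardLaw {d : ℕ} (q0 : Measure (Vec d)) (u : ℝ) : Measure (Vec d) :=
  Measure.map (fun p : Vec d × Vec d =>
      Real.exp (-u) • p.1 + Real.sqrt (1 - Real.exp (-2*u)) • p.2)
    (q0.prod (stdGaussian d))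

/-- Gaussian weight `exp(-‖x - λ_t θ‖² / (2σ_t²))`. -/
def weight {d : ℕ} (t : ℝ) (x θ : Vec d) : ℝ :=
  Real.exp (-‖x - Real.exp (-t) • θ‖^2 / (2 * (1 - Real.exp (-2*t))))

/-- The conditional law `μ_{t,x}` of `θ` given `λ_t θ + σ_t g = x`:
`dμ_{t,x}(θ) = Z_{t,x}⁻¹ exp(-‖x - λ_t θ‖²/(2σ_t²)) dq0(θ)`. -/
def condMeasure {d : ℕ} (q0 : Measure (Vec d)) (t : ℝ) (x : Vec d) : Measure (Vec d) :=
  (∫⁻ θ, ENNReal.ofReal (weight t x θ) ∂q0)⁻¹ •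
    q0.withDensity fun θ => ENNReal.ofReal (weight t x θ)

/-- The conditional mean `m(t, x) = E_{t,x}[θ]`. -/
def condMean {d : ℕ} (q0 : Measure (Vec d)) (t : ℝ) (x : Vec d) : Vec d :=
  ∫ θ, θ ∂(condMeasure q0 t x)

/-- Partial derivative in the `i`-th coordinate direction. -/
def pd {d : ℕ} (i : Fin d) (f : Vec d → ℝ) (x : Vec d) : ℝ :=
  fderiv ℝ f x (EuclideanSpace.single i 1)

/-- The auxiliary function `f₀(θ, x, t) = (λ_t²/σ_t⁴)‖θ‖² - ((λ_t + λ_t³)/σ_t⁴)⟨x, θ⟩`. -/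
def f0 {d : ℕ} (t : ℝ) (x θ : Vec d) : ℝ :=
  Real.exp (-t)^2 / (1 - Real.exp (-2*t))^2 * ‖θ‖^2
    - (Real.exp (-t) + Real.exp (-t)^3) / (1 - Real.exp (-2*t))^2 * @inner ℝ _ _ x θ

lemma pi_gaussianReal_eq_withDensity (d : ℕ) :
    Measure.pi (fun _ : Fin d => gaussianReal 0 1)
      = volume.withDensity fun x => ENNReal.ofReal (∏ i, gaussianPDFReal 0 1 (x i)) := by
  refine Measure.pi_eq fun s hs => ?_
  have hbox : MeasurableSet (Set.univ.pi s) := MeasurableSet.univ_pi hs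
  have hint : ∀ i, Integrable ((s i).indicator (gaussianPDFReal 0 1)) :=
    fun i => (integrable_gaussianPDFReal 0 1).indicator (hs i)
  have hind : ∀ x : Fin d → ℝ, (Set.univ.pi s).indicator
      (fun x => ENNReal.ofReal (∏ i, gaussianPDFReal 0 1 (x i))) x
        = ENNReal.ofReal (∏ i, (s i).indicator (gaussianPDFReal 0 1) (x i)) := by
    intro x
    by_cases hx : x ∈ Set.univ.pi s
    · rw [Set.indicator_of_mem hx]
      congr 1
      exact Finset.prod_congr rfl fun i _ => (Set.indicator_of_mem (hx i trivial) _).symm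
    · rw [Set.indicator_of_notMem hx]
      obtain ⟨i, hi⟩ : ∃ i, x i ∉ s i := by simpa [Set.mem_pi] using hx
      rw [Finset.prod_eq_zero (Finset.mem_univ i) (Set.indicator_of_notMem hi _)]
      simp
  have hnn : ∀ i y, 0 ≤ (s i).indicator (gaussianPDFReal 0 1) y :=
    fun i y => Set.indicator_nonneg (fun z _ => gaussianPDFReal_nonneg 0 1 z) y
  rw [withDensity_apply _ hbox, ← lintegral_indicator hbox, lintegral_congr hind,
    ← ofReal_integral_eq_lintegral_ofReal (by exact Integrable.fintype_prod hint)
      (Filter.Eventually.of_forall fun x => Finset.prod_nonneg fun i _ => hnn i (x i)),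
    integral_fintype_prod_volume_eq_prod,
    ENNReal.ofReal_prod_of_nonneg fun i _ => integral_nonneg (hnn i)]
  refine Finset.prod_congr rfl fun i _ => ?_
  rw [integral_indicator (hs i), gaussianReal_apply_eq_integral 0 one_ne_zero]

lemma prod_gaussianPDFReal_eq {d : ℕ} (x : Vec d) :
    ∏ i, gaussianPDFReal 0 1 (x i)
      = ((Real.sqrt (2 * π))⁻¹) ^ d * Real.exp (-‖x‖ ^ 2 / 2) := by
  simp only [gaussianPDFReal, Finset.prod_mul_distrib, ← Real.exp_sum]
  simp [EuclideanSpace.norm_sq_eq, Finset.sum_div, neg_div]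

lemma stdGaussian_eq_withDensity (d : ℕ) :
    stdGaussian d = volume.withDensity fun g : Vec d =>
      ENNReal.ofReal (((Real.sqrt (2 * π))⁻¹) ^ d * Real.exp (-‖g‖ ^ 2 / 2)) := by
  have hmp := PiLp.volume_preserving_toLp (Fin d)
  have hm : Measurable fun g : Vec d =>
      ENNReal.ofReal (((Real.sqrt (2 * π))⁻¹) ^ d * Real.exp (-‖g‖ ^ 2 / 2)) := by fun_prop
  have he : Measurable (⇑(EuclideanSpace.equiv (Fin d) ℝ).symm) :=
    (EuclideanSpace.equiv (Fin d) ℝ).symm.continuous.measurable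
  refine Measure.ext fun s hs => ?_
  rw [_root_.stdGaussian, Measure.map_apply he hs, pi_gaussianReal_eq_withDensity,
    withDensity_apply _ (he hs), withDensity_apply _ hs,
    ← hmp.setLIntegral_comp_preimage hs hm]
  refine lintegral_congr fun x => ?_
  rw [← prod_gaussianPDFReal_eq]

lemma lintegral_stdGaussian_affine {d : ℕ} {σ : ℝ} (hσ : 0 < σ) (a : Vec d)
    {f : Vec d → ENNReal} (hf : Measurable f) :
    ∫⁻ g, f (a + σ • g) ∂(stdGaussian d)
      = ENNReal.ofReal ((σ ^ d)⁻¹ * ((Real.sqrt (2 * π))⁻¹) ^ d)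
        * ∫⁻ y, ENNReal.ofReal (Real.exp (-‖y - a‖ ^ 2 / (2 * σ ^ 2))) * f y := by
  set c : ℝ := ((Real.sqrt (2 * π))⁻¹) ^ d
  have hc : 0 ≤ c := by positivity
  have hw : Measurable fun z : Vec d =>
      ENNReal.ofReal (c * Real.exp (-‖z‖ ^ 2 / (2 * σ ^ 2))) * f (a + z) := by fun_prop
  calc ∫⁻ g, f (a + σ • g) ∂(stdGaussian d)
      = ∫⁻ g, ENNReal.ofReal (c * Real.exp (-‖σ • g‖ ^ 2 / (2 * σ ^ 2))) * f (a + σ • g) := by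
        rw [stdGaussian_eq_withDensity, lintegral_withDensity_eq_lintegral_mul _
          (by fun_prop) (by fun_prop)]
        refine lintegral_congr fun g => ?_
        simp only [Pi.mul_apply]
        congr 4
        rw [norm_smul, Real.norm_of_nonneg hσ.le]
        field_simp
    _ = ∫⁻ z, ENNReal.ofReal (c * Real.exp (-‖z‖ ^ 2 / (2 * σ ^ 2))) * f (a + z)
          ∂(Measure.map (σ • ·) (volume : Measure (Vec d))) :=
        (lintegral_map hw (measurable_const_smul σ)).symm
    _ = ENNReal.ofReal ((σ ^ d)⁻¹) *
          ∫⁻ z, ENNReal.ofReal (c * Real.exp (-‖z‖ ^ 2 / (2 * σ ^ 2))) * f (a + z) := by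
        rw [Measure.map_addHaar_smul _ hσ.ne', lintegral_smul_measure, smul_eq_mul,
          finrank_euclideanSpace_fin, abs_of_pos (by positivity)]
    _ = ENNReal.ofReal ((σ ^ d)⁻¹) *
          ∫⁻ y, ENNReal.ofReal (c * Real.exp (-‖y - a‖ ^ 2 / (2 * σ ^ 2))) * f y := by
        rw [← lintegral_add_left_eq_self (fun y =>
          ENNReal.ofReal (c * Real.exp (-‖y - a‖ ^ 2 / (2 * σ ^ 2))) * f y) a]
        simp
    _ = _ := by
        simp_rw [ENNReal.ofReal_mul hc, mul_assoc]
        rw [ENNReal.ofReal_mul (by positivity), mul_assoc, lintegral_const_mul _ (by fun_prop)]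

lemma one_sub_exp_pos {u : ℝ} (hu : 0 < u) : 0 < 1 - Real.exp (-2 * u) := by
  have : Real.exp (-2 * u) < 1 := by rw [Real.exp_lt_one_iff]; linarith
  linarith

lemma continuous_weight {d : ℕ} (u : ℝ) : Continuous fun p : Vec d × Vec d => weight u p.1 p.2 := by
  unfold weight
  fun_prop

lemma weight_pos {d : ℕ} (u : ℝ) (x θ : Vec d) : 0 < weight u x θ := Real.exp_pos _

lemma weight_le_one {d : ℕ} {u : ℝ} (hu : 0 < u) (x θ : Vec d) : weight u x θ ≤ 1 := by
  have := one_sub_exp_pos hu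
  refine Real.exp_le_one_iff.2 ?_
  rw [neg_div]
  exact neg_nonpos.2 (by positivity)

lemma continuous_weight_right {d : ℕ} (u : ℝ) (x : Vec d) : Continuous (weight u x) := by
  unfold weight
  fun_prop

lemma continuous_weight_left {d : ℕ} (u : ℝ) (θ : Vec d) : Continuous fun x => weight u x θ := by
  unfold weight
  fun_prop

lemma integrable_weight_mul {d : ℕ} {q0 : Measure (Vec d)} {u : ℝ} (hu : 0 < u) (x : Vec d)
    {F : Vec d → ℝ} (hF : Integrable F q0) : Integrable (fun θ => weight u x θ * F θ) q0 :=
  hF.bdd_mul (c := 1) (continuous_weight_right u x).aestronglyMeasurable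
    (Filter.Eventually.of_forall fun θ => by
      rw [Real.norm_of_nonneg (weight_pos u x θ).le]; exact weight_le_one hu x θ)

lemma integrable_weight {d : ℕ} (q0 : Measure (Vec d)) [IsProbabilityMeasure q0]
    {u : ℝ} (hu : 0 < u) (x : Vec d) : Integrable (weight u x) q0 := by
  simpa using integrable_weight_mul hu x (integrable_const (μ := q0) (1 : ℝ))

lemma integral_weight_pos {d : ℕ} (q0 : Measure (Vec d)) [IsProbabilityMeasure q0]
    {u : ℝ} (hu : 0 < u) (x : Vec d) : 0 < ∫ θ, weight u x θ ∂q0 := by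
  rw [integral_pos_iff_support_of_nonneg (fun θ => (weight_pos u x θ).le)
    (integrable_weight q0 hu x)]
  have : Function.support (weight u x) = Set.univ :=
    Set.eq_univ_of_forall fun θ => (weight_pos u x θ).ne'
  simp [this]

lemma continuous_integral_weight {d : ℕ} (q0 : Measure (Vec d)) [IsProbabilityMeasure q0]
    {u : ℝ} (hu : 0 < u) : Continuous fun x => ∫ θ, weight u x θ ∂q0 :=
  continuous_of_dominated (bound := fun _ => 1)
    (fun x => (continuous_weight_right u x).aestronglyMeasurable)
    (fun x => Filter.Eventually.of_forall fun θ => by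
      rw [Real.norm_of_nonneg (weight_pos u x θ).le]; exact weight_le_one hu x θ)
    (integrable_const _)
    (Filter.Eventually.of_forall fun θ => continuous_weight_left u θ)

lemma forwardLaw_eq_withDensity {d : ℕ} (q0 : Measure (Vec d)) [IsProbabilityMeasure q0]
    {u : ℝ} (hu : 0 < u) :
    ∃ c : ℝ, 0 < c ∧ forwardLaw q0 u
      = volume.withDensity fun y => ENNReal.ofReal (c * ∫ θ, weight u y θ ∂q0) := by
  have hv := one_sub_exp_pos hu
  set σ := Real.sqrt (1 - Real.exp (-2 * u))
  have hσ : 0 < σ := Real.sqrt_pos.2 hv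
  have hσ2 : σ ^ 2 = 1 - Real.exp (-2 * u) := Real.sq_sqrt hv.le
  set c : ℝ := (σ ^ d)⁻¹ * ((Real.sqrt (2 * π))⁻¹) ^ d
  have hc : 0 < c := by positivity
  refine ⟨c, hc, Measure.ext_of_lintegral _ fun f hf => ?_⟩
  have : IsProbabilityMeasure (stdGaussian d) :=
    Measure.isProbabilityMeasure_map
      (EuclideanSpace.equiv (Fin d) ℝ).symm.continuous.measurable.aemeasurable
  have hwm : Measurable fun p : Vec d × Vec d => ENNReal.ofReal (weight u p.2 p.1) * f p.2 :=
    (((continuous_weight u).measurable.comp measurable_swap).ennreal_ofReal).mul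
      (hf.comp measurable_snd)
  have hzm : Measurable fun y => ENNReal.ofReal (c * ∫ θ, weight u y θ ∂q0) :=
    ((continuous_integral_weight q0 hu).measurable.const_mul c).ennreal_ofReal
  calc ∫⁻ y, f y ∂(forwardLaw q0 u)
      = ∫⁻ θ, ∫⁻ g, f (Real.exp (-u) • θ + σ • g) ∂(stdGaussian d) ∂q0 := by
        rw [forwardLaw, lintegral_map hf (by fun_prop), lintegral_prod _ (by fun_prop)]
    _ = ∫⁻ θ, ENNReal.ofReal c * ∫⁻ y, ENNReal.ofReal (weight u y θ) * f y ∂volume ∂q0 := by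
        refine lintegral_congr fun θ => ?_
        rw [lintegral_stdGaussian_affine hσ _ hf, hσ2]
        rfl
    _ = ENNReal.ofReal c * ∫⁻ θ, ∫⁻ y, ENNReal.ofReal (weight u y θ) * f y ∂volume ∂q0 :=
        lintegral_const_mul _ hwm.lintegral_prod_right'
    _ = ENNReal.ofReal c * ∫⁻ y, ∫⁻ θ, ENNReal.ofReal (weight u y θ) * f y ∂q0 ∂volume := by
        rw [lintegral_lintegral_swap hwm.aemeasurable]
    _ = ∫⁻ y, ENNReal.ofReal (c * ∫ θ, weight u y θ ∂q0) * f y := by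
        rw [← lintegral_const_mul _ (by exact hwm.lintegral_prod_left')]
        refine lintegral_congr fun y => ?_
        rw [lintegral_mul_const _ (continuous_weight_right u y).measurable.ennreal_ofReal,
          ENNReal.ofReal_mul hc.le, ofReal_integral_eq_lintegral_ofReal (integrable_weight q0 hu y)
            (Filter.Eventually.of_forall fun θ => (weight_pos u y θ).le), mul_assoc]
    _ = _ := by
        rw [lintegral_withDensity_eq_lintegral_mul _ hzm hf]
        rfl

/-- A continuous positive density of `q_u` is a constant multiple of `∫ weight u x θ dq0(θ)`. -/
lemma density_eq_const_mul_integral_weight {d : ℕ} (q0 : Measure (Vec d)) [IsProbabilityMeasure q0]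
    {u : ℝ} (hu : 0 < u) {p : Vec d → ℝ} (hp : Continuous p) (hpos : ∀ x, 0 < p x)
    (h : forwardLaw q0 u = volume.withDensity fun x => ENNReal.ofReal (p x)) :
    ∃ c : ℝ, 0 < c ∧ ∀ x, p x = c * ∫ θ, weight u x θ ∂q0 := by
  obtain ⟨c, hc, hlaw⟩ := forwardLaw_eq_withDensity q0 hu
  have hcont := (continuous_integral_weight q0 hu).const_mul c
  refine ⟨c, hc, congrFun ((Continuous.ae_eq_iff_eq volume hp hcont).1 ?_)⟩
  rw [h, withDensity_eq_iff_of_sigmaFinite hp.measurable.ennreal_ofReal.aemeasurable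
    hcont.measurable.ennreal_ofReal.aemeasurable] at hlaw
  filter_upwards [hlaw] with x hx
  exact (ENNReal.ofReal_eq_ofReal_iff (hpos x).le
    (mul_pos hc (integral_weight_pos q0 hu x)).le).1 hx

lemma exp_neg_two_mul (u : ℝ) : Real.exp (-2 * u) = Real.exp (-u) ^ 2 := by
  rw [← Real.exp_nat_mul]
  congr 1
  push_cast
  ring

lemma integral_condMeasure {d : ℕ} (q0 : Measure (Vec d)) [IsProbabilityMeasure q0]
    {E : Type*} [NormedAddCommGroup E] [NormedSpace ℝ E]
    {u : ℝ} (hu : 0 < u) (x : Vec d) (F : Vec d → E) :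
    ∫ θ, F θ ∂(condMeasure q0 u x)
      = (∫ θ, weight u x θ ∂q0)⁻¹ • ∫ θ, weight u x θ • F θ ∂q0 := by
  have hnn : ∀ θ, 0 ≤ weight u x θ := fun θ => (weight_pos u x θ).le
  rw [condMeasure, integral_smul_measure, integral_withDensity_eq_integral_toReal_smul
    (continuous_weight_right u x).measurable.ennreal_ofReal (by simp),
    ← ofReal_integral_eq_lintegral_ofReal (integrable_weight q0 hu x)
      (Filter.Eventually.of_forall hnn), ENNReal.toReal_inv,
    ENNReal.toReal_ofReal (integral_nonneg hnn)]
  simp only [ENNReal.toReal_ofReal (hnn _)]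

lemma condMean_apply {d : ℕ} (q0 : Measure (Vec d)) [IsProbabilityMeasure q0]
    {u : ℝ} (hu : 0 < u) (x : Vec d) (hint : Integrable (fun θ => ‖θ‖) q0) (i : Fin d) :
    condMean q0 u x i
      = (∫ θ, weight u x θ * θ i ∂q0) / ∫ θ, weight u x θ ∂q0 := by
  have hw : Integrable (fun θ => weight u x θ • θ) q0 := by
    refine (integrable_weight_mul hu x hint).mono
      ((continuous_weight_right u x).smul continuous_id).aestronglyMeasurable
      (Filter.Eventually.of_forall fun θ => ?_)
    simp [norm_smul]
  have hproj := (EuclideanSpace.proj (𝕜 := ℝ) i).integral_comp_comm hw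
  simp only [PiLp.proj_apply, PiLp.smul_apply, smul_eq_mul] at hproj
  rw [condMean, integral_condMeasure q0 hu, PiLp.smul_apply, ← hproj, smul_eq_mul, div_eq_inv_mul]

lemma integrable_norm_pow_of_le_four {d : ℕ} {q0 : Measure (Vec d)} [IsProbabilityMeasure q0]
    (hmom : Integrable (fun θ => ‖θ‖ ^ 4) q0) {k : ℕ} (hk : k ≤ 4) :
    Integrable (fun θ => ‖θ‖ ^ k) q0 := by
  refine ((integrable_const 1).add hmom).mono (by fun_prop)
    (Filter.Eventually.of_forall fun θ => ?_)
  have h0 := norm_nonneg θ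
  simp only [Pi.add_apply]
  rw [Real.norm_of_nonneg (by positivity), Real.norm_of_nonneg (by positivity)]
  rcases le_total ‖θ‖ 1 with h | h
  · exact (pow_le_one₀ h0 h).trans (le_add_of_nonneg_right (by positivity))
  · exact (pow_le_pow_right₀ h hk).trans (le_add_of_nonneg_left zero_le_one)

/-- Spatial derivative of the weight along a coordinate direction. -/
lemma hasDerivAt_weight_line {d : ℕ} {u : ℝ} (hu : 0 < u) (x θ : Vec d) (i : Fin d) (s : ℝ) :
    HasDerivAt (fun s => weight u (x + s • EuclideanSpace.single i (1 : ℝ)) θ)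
      (-(x i + s - Real.exp (-u) * θ i) / (1 - Real.exp (-2 * u))
        * weight u (x + s • EuclideanSpace.single i (1 : ℝ)) θ) s := by
  have hS := (one_sub_exp_pos hu).ne'
  have hline : HasDerivAt (fun s : ℝ => x + s • EuclideanSpace.single i (1 : ℝ)
      - Real.exp (-u) • θ) (EuclideanSpace.single i (1 : ℝ)) s := by
    simpa using (((hasDerivAt_id s).smul_const (EuclideanSpace.single i (1 : ℝ))).const_add
      x).sub_const (Real.exp (-u) • θ)
  have h := ((hline.norm_sq.neg).div_const (2 * (1 - Real.exp (-2 * u)))).exp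
  refine h.congr_deriv ?_
  simp only [weight, EuclideanSpace.inner_single_right]
  simp
  field_simp
  ring

/-- Time derivative of the weight. -/
lemma hasDerivAt_weight_time {d : ℕ} {u : ℝ} (hu : 0 < u) (x θ : Vec d) :
    HasDerivAt (fun v => weight v x θ)
      (weight u x θ * (f0 u x θ
        + Real.exp (-u) ^ 2 / (1 - Real.exp (-2 * u)) ^ 2 * ‖x‖ ^ 2)) u := by
  have hS := (one_sub_exp_pos hu).ne'
  have hexp : HasDerivAt (fun v : ℝ => Real.exp (-v)) (-Real.exp (-u)) u := by
    simpa using (hasDerivAt_neg u).exp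
  have hexp2 : HasDerivAt (fun v : ℝ => 2 * (1 - Real.exp (-2 * v)))
      (4 * Real.exp (-u) ^ 2) u := by
    have := ((((hasDerivAt_id u).const_mul (-2)).exp.const_sub 1).const_mul 2)
    refine this.congr_deriv ?_
    simp only [id, exp_neg_two_mul]
    ring
  have hvec : HasDerivAt (fun v : ℝ => x - Real.exp (-v) • θ) (Real.exp (-u) • θ) u := by
    simpa using (hexp.smul_const θ).const_sub x
  have h := (hvec.norm_sq.neg.div hexp2 (mul_ne_zero two_ne_zero hS)).exp
  refine h.congr_deriv ?_
  simp only [weight, f0, Pi.neg_apply]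
  congr 1
  rw [norm_sub_sq_real, inner_sub_left, inner_smul_right, inner_smul_right,
    inner_smul_left, real_inner_self_eq_norm_sq, norm_smul, Real.norm_of_nonneg (Real.exp_pos _).le]
  rw [exp_neg_two_mul] at hS ⊢
  simp only [conj_trivial]
  field_simp
  ring

lemma abs_f0_add_le {d : ℕ} {u S : ℝ} (hu : 0 < u) (hS : 0 < S)
    (hSu : S ≤ 1 - Real.exp (-2 * u)) (x θ : Vec d) :
    |f0 u x θ + Real.exp (-u) ^ 2 / (1 - Real.exp (-2 * u)) ^ 2 * ‖x‖ ^ 2|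
      ≤ (‖θ‖ + ‖x‖) ^ 2 / S ^ 2 := by
  have hl0 := Real.exp_pos (-u)
  have hl1 : Real.exp (-u) ≤ 1 := Real.exp_le_one_iff.2 (by linarith)
  set l := Real.exp (-u)
  set V := 1 - Real.exp (-2 * u)
  have hV : 0 < V := hS.trans_le hSu
  have hl2 : l ^ 2 ≤ 1 := pow_le_one₀ hl0.le hl1
  have hl3 : l ^ 3 ≤ 1 := pow_le_one₀ hl0.le hl1
  have hnum : |l ^ 2 * ‖θ‖ ^ 2 - (l + l ^ 3) * inner ℝ x θ + l ^ 2 * ‖x‖ ^ 2|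
      ≤ (‖θ‖ + ‖x‖) ^ 2 := by
    have h1 : |l ^ 2 * ‖θ‖ ^ 2| ≤ ‖θ‖ ^ 2 := by
      rw [abs_of_nonneg (by positivity)]; exact mul_le_of_le_one_left (by positivity) hl2
    have h2 : |l ^ 2 * ‖x‖ ^ 2| ≤ ‖x‖ ^ 2 := by
      rw [abs_of_nonneg (by positivity)]; exact mul_le_of_le_one_left (by positivity) hl2
    have h3 : |(l + l ^ 3) * inner ℝ x θ| ≤ 2 * (‖x‖ * ‖θ‖) := by
      rw [abs_mul, abs_of_nonneg (by positivity)]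
      exact mul_le_mul (by linarith) (abs_real_inner_le_norm x θ) (abs_nonneg _) zero_le_two
    calc _ ≤ |l ^ 2 * ‖θ‖ ^ 2| + |(l + l ^ 3) * inner ℝ x θ| + |l ^ 2 * ‖x‖ ^ 2| :=
          (abs_add_le _ _).trans (add_le_add_left (abs_sub _ _) _)
      _ ≤ (‖θ‖ + ‖x‖) ^ 2 := by linarith
  have heq : f0 u x θ + l ^ 2 / V ^ 2 * ‖x‖ ^ 2
      = (l ^ 2 * ‖θ‖ ^ 2 - (l + l ^ 3) * inner ℝ x θ + l ^ 2 * ‖x‖ ^ 2) / V ^ 2 := by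
    simp only [f0]
    ring
  rw [heq, abs_div, abs_of_pos (by positivity : 0 < V ^ 2)]
  gcongr

lemma continuous_f0 {d : ℕ} (u : ℝ) (x : Vec d) : Continuous (f0 u x) := by
  unfold f0
  fun_prop

lemma hasDerivAt_integral_weight_mul {d : ℕ} {q0 : Measure (Vec d)}
    {t : ℝ} (ht : 0 < t) (x : Vec d) {F : Vec d → ℝ} (hF : Continuous F)
    (hFint : Integrable F q0) (hFint' : Integrable (fun θ => F θ * (‖θ‖ + ‖x‖) ^ 2) q0) :
    HasDerivAt (fun u => ∫ θ, weight u x θ * F θ ∂q0)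
      (∫ θ, weight t x θ * (f0 t x θ
        + Real.exp (-t) ^ 2 / (1 - Real.exp (-2 * t)) ^ 2 * ‖x‖ ^ 2) * F θ ∂q0) t := by
  have ht2 : 0 < t / 2 := by positivity
  have hS := one_sub_exp_pos ht2
  refine (hasDerivAt_integral_of_dominated_loc_of_deriv_le (s := Set.Ioi (t / 2))
    (bound := fun θ => ‖F θ * (‖θ‖ + ‖x‖) ^ 2‖ / (1 - Real.exp (-2 * (t / 2))) ^ 2)
    (F' := fun u θ => weight u x θ * (f0 u x θ
        + Real.exp (-u) ^ 2 / (1 - Real.exp (-2 * u)) ^ 2 * ‖x‖ ^ 2) * F θ)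
    (Ioi_mem_nhds (by linarith)) (Filter.Eventually.of_forall fun u =>
      ((continuous_weight_right u x).mul hF).aestronglyMeasurable)
    (integrable_weight_mul ht x hFint)
    (((continuous_weight_right t x).mul
      ((continuous_f0 t x).add continuous_const)).mul hF).aestronglyMeasurable
    (Filter.Eventually.of_forall fun θ u hu => ?_) (hFint'.norm.div_const _)
    (Filter.Eventually.of_forall fun θ u hu =>
      (hasDerivAt_weight_time (ht2.trans hu) x θ).mul_const (F θ))).2
  have hu' : t / 2 < u := hu
  have hu0 : 0 < u := ht2.trans hu'
  have hSu : 1 - Real.exp (-2 * (t / 2)) ≤ 1 - Real.exp (-2 * u) :=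
    sub_le_sub_left (Real.exp_le_exp.2 (by linarith)) 1
  rw [norm_mul, norm_mul, Real.norm_of_nonneg (weight_pos u x θ).le, Real.norm_eq_abs (_ + _),
    norm_mul, Real.norm_of_nonneg (by positivity : 0 ≤ (‖θ‖ + ‖x‖) ^ 2), mul_comm, mul_div_assoc]
  gcongr
  exact (mul_le_of_le_one_left (abs_nonneg _) (weight_le_one hu0 x θ)).trans
    (abs_f0_add_le hu0 hS hSu x θ)

/-- Derivative of `∫ weight u x θ dq0(θ)` in the `i`-th coordinate of `x`. -/
lemma hasDerivAt_integral_weight_line {d : ℕ} {q0 : Measure (Vec d)} [IsProbabilityMeasure q0]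
    {u : ℝ} (hu : 0 < u) (x : Vec d) (hint : Integrable (fun θ => ‖θ‖) q0) (i : Fin d) :
    HasDerivAt (fun s : ℝ => ∫ θ, weight u (x + s • EuclideanSpace.single i (1 : ℝ)) θ ∂q0)
      ((Real.exp (-u) * ∫ θ, weight u x θ * θ i ∂q0) / (1 - Real.exp (-2 * u))
        - x i * (∫ θ, weight u x θ ∂q0) / (1 - Real.exp (-2 * u))) 0 := by
  have hS := one_sub_exp_pos hu
  have hl1 : Real.exp (-u) ≤ 1 := Real.exp_le_one_iff.2 (by linarith)
  have hcoord : Integrable (fun θ : Vec d => θ i) q0 :=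
    hint.mono (by fun_prop) (Filter.Eventually.of_forall fun θ => by
      simpa using PiLp.norm_apply_le θ i)
  have key := (hasDerivAt_integral_of_dominated_loc_of_deriv_le (μ := q0) (x₀ := (0 : ℝ))
    (s := Metric.ball (0 : ℝ) 1)
    (F := fun s θ => weight u (x + s • EuclideanSpace.single i (1 : ℝ)) θ)
    (F' := fun s θ => -(x i + s - Real.exp (-u) * θ i) / (1 - Real.exp (-2 * u))
        * weight u (x + s • EuclideanSpace.single i (1 : ℝ)) θ)
    (bound := fun θ => (|x i| + 1 + ‖θ‖) / (1 - Real.exp (-2 * u)))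
    (Metric.ball_mem_nhds 0 one_pos)
    (Filter.Eventually.of_forall fun s => (continuous_weight_right u _).aestronglyMeasurable)
    (integrable_weight q0 hu _)
    (Continuous.aestronglyMeasurable
      (Continuous.mul (by fun_prop) (continuous_weight_right u _)))
    (Filter.Eventually.of_forall fun θ s hs => ?_)
    (((integrable_const _).add hint).div_const _)
    (Filter.Eventually.of_forall fun θ s _ => hasDerivAt_weight_line hu x θ i s)).2
  · refine key.congr_deriv ?_
    rw [← integral_const_mul, ← integral_const_mul, ← integral_div, ← integral_div,
      ← integral_sub (((integrable_weight_mul hu x hcoord).const_mul _).div_const _)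
        (((integrable_weight q0 hu x).const_mul _).div_const _)]
    refine integral_congr_ae (Filter.Eventually.of_forall fun θ => ?_)
    simp only [zero_smul, add_zero]
    ring
  · have hs' : |s| ≤ 1 := by simpa using (mem_ball_zero_iff.1 hs).le
    have hθ : |Real.exp (-u) * θ i| ≤ ‖θ‖ := by
      rw [abs_mul, abs_of_pos (Real.exp_pos _)]
      exact (mul_le_of_le_one_left (abs_nonneg _) hl1).trans (by
        simpa using PiLp.norm_apply_le θ i)
    rw [norm_mul, Real.norm_of_nonneg (weight_pos u _ θ).le, norm_div, norm_neg,
      Real.norm_of_nonneg hS.le, Real.norm_eq_abs]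
    refine (mul_le_of_le_one_right (by positivity) (weight_le_one hu _ θ)).trans ?_
    gcongr
    exact (abs_sub _ _).trans (add_le_add ((abs_add_le _ _).trans (by gcongr)) hθ)

/-- Tweedie's formula for the score of a smooth positive density of `q_u`. -/
lemma pd_log_density_eq {d : ℕ} {q0 : Measure (Vec d)} [IsProbabilityMeasure q0]
    {u : ℝ} (hu : 0 < u) {p : Vec d → ℝ} (hp : Differentiable ℝ p) (hpos : ∀ x, 0 < p x)
    (h : forwardLaw q0 u = volume.withDensity fun x => ENNReal.ofReal (p x))
    (hint : Integrable (fun θ => ‖θ‖) q0) (x : Vec d) (i : Fin d) :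
    pd i (fun y => Real.log (p y)) x
      = (Real.exp (-u) * ((∫ θ, weight u x θ * θ i ∂q0) / ∫ θ, weight u x θ ∂q0) - x i)
        / (1 - Real.exp (-2 * u)) := by
  obtain ⟨c, hc, hpc⟩ := density_eq_const_mul_integral_weight q0 hu hp.continuous hpos h
  have hZ := integral_weight_pos q0 hu x
  have hS := one_sub_exp_pos hu
  have hline : HasLineDerivAt ℝ (fun y => Real.log (p y))
      (pd i (fun y => Real.log (p y)) x) x (EuclideanSpace.single i (1 : ℝ)) :=
    ((hp x).log (hpos x).ne').hasFDerivAt.hasLineDerivAt _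
  have hline' := ((hasDerivAt_integral_weight_line hu x hint i).const_mul c).log
    (by simpa using (mul_pos hc hZ).ne')
  simp only [HasLineDerivAt, hpc] at hline
  simp only [hpc]
  rw [hline.unique hline']
  simp only [zero_smul, add_zero]
  field_simp

/-- **Lemma (time derivative of the score, `f₀` form).** If `q0` has finite fourth moment then
for `t > 0` and `x ∈ ℝ^d`,
`∂_t ∇_x log q_t(x) = -((λ_t+λ_t³)/σ_t⁴) m(t,x) + (2λ_t²/σ_t⁴) x
  + (λ_t/σ_t²) E_{t,x}[(θ - m(t,x)) f₀(θ,x,t)]`, stated coordinatewise. -/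
theorem partial_t_score_f0
    {d : ℕ} (hd : 1 ≤ d) (q0 : Measure (Vec d)) [IsProbabilityMeasure q0]
    (ρ : ℝ → Vec d → ℝ)
    (hρ : ∀ u, 0 < u → forwardLaw q0 u = volume.withDensity fun x => ENNReal.ofReal (ρ u x))
    (hρpos : ∀ u, 0 < u → ∀ x, 0 < ρ u x)
    (hρsmooth : ∀ u, 0 < u → ContDiff ℝ (⊤ : ℕ∞) (ρ u))
    (hmom : Integrable (fun θ => ‖θ‖^4) q0)
    (t : ℝ) (ht : 0 < t) (x : Vec d) (i : Fin d) :
    HasDerivAt (fun u => pd i (fun y => Real.log (ρ u y)) x)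
      (-((Real.exp (-t) + Real.exp (-t)^3) / (1 - Real.exp (-2*t))^2) * condMean q0 t x i
        + (2 * Real.exp (-t)^2 / (1 - Real.exp (-2*t))^2) * x i
        + (Real.exp (-t) / (1 - Real.exp (-2*t)))
          * ∫ θ, (θ i - condMean q0 t x i) * f0 t x θ ∂(condMeasure q0 t x)) t := by
  have hint : ∀ k ≤ 4, Integrable (fun θ => ‖θ‖ ^ k) q0 :=
    fun k hk => integrable_norm_pow_of_le_four hmom hk
  have hint1 : Integrable (fun θ => ‖θ‖) q0 := by simpa using hint 1 (by norm_num)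
  have hquad : Integrable (fun θ => 1 * (‖θ‖ + ‖x‖) ^ 2) q0 := by
    have := ((hint 2 (by norm_num)).add (hint1.const_mul (2 * ‖x‖))).add
      (integrable_const (‖x‖ ^ 2))
    refine this.congr (Filter.Eventually.of_forall fun θ => ?_)
    simp only [Pi.add_apply]
    ring
  have hcubic : Integrable (fun θ => ‖θ‖ * (‖θ‖ + ‖x‖) ^ 2) q0 := by
    have := ((hint 3 (by norm_num)).add ((hint 2 (by norm_num)).const_mul (2 * ‖x‖))).add
      (hint1.const_mul (‖x‖ ^ 2))
    refine this.congr (Filter.Eventually.of_forall fun θ => ?_)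
    simp only [Pi.add_apply]
    ring
  have hcoord : ∀ θ : Vec d, |θ i| ≤ ‖θ‖ := fun θ => by simpa using PiLp.norm_apply_le θ i
  have hcoord_int : Integrable (fun θ : Vec d => θ i) q0 :=
    hint1.mono (by fun_prop) (Filter.Eventually.of_forall fun θ => by simpa using hcoord θ)
  have hcoord_quad : Integrable (fun θ : Vec d => θ i * (‖θ‖ + ‖x‖) ^ 2) q0 := by
    refine hcubic.mono (by fun_prop) (Filter.Eventually.of_forall fun θ => ?_)
    rw [norm_mul, norm_mul, norm_norm, Real.norm_eq_abs (θ i)]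
    gcongr
    exact hcoord θ
  have hS := one_sub_exp_pos ht
  have hZ := integral_weight_pos q0 ht x
  set κ : ℝ := Real.exp (-t) ^ 2 / (1 - Real.exp (-2 * t)) ^ 2 * ‖x‖ ^ 2 with hκ
  have hf0_bound : ∀ θ, |f0 t x θ + κ| ≤ (‖θ‖ + ‖x‖) ^ 2 / (1 - Real.exp (-2 * t)) ^ 2 :=
    fun θ => abs_f0_add_le ht hS le_rfl x θ
  have hf0_int : ∀ {F : Vec d → ℝ}, Continuous F → Integrable F q0 →
      Integrable (fun θ => F θ * (‖θ‖ + ‖x‖) ^ 2) q0 →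
      Integrable (fun θ => weight t x θ * (f0 t x θ * F θ)) q0 := by
    intro F hF hFint hFquad
    have h : Integrable (fun θ => (f0 t x θ + κ) * F θ) q0 := by
      refine (hFquad.div_const ((1 - Real.exp (-2 * t)) ^ 2)).mono
        ((((continuous_f0 t x).add continuous_const).mul hF).aestronglyMeasurable)
        (Filter.Eventually.of_forall fun θ => ?_)
      rw [norm_mul, mul_div_assoc, norm_mul, mul_comm]
      gcongr
      exact (hf0_bound θ).trans (le_abs_self _)
    refine integrable_weight_mul ht x ((h.sub (hFint.const_mul κ)).congr
      (Filter.Eventually.of_forall fun θ => ?_))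
    simp only [Pi.sub_apply]
    ring
  have hsplit : ∀ {F : Vec d → ℝ}, Continuous F → Integrable F q0 →
      Integrable (fun θ => F θ * (‖θ‖ + ‖x‖) ^ 2) q0 →
      ∫ θ, weight t x θ * (f0 t x θ + κ) * F θ ∂q0
        = (∫ θ, weight t x θ * (f0 t x θ * F θ) ∂q0) + κ * ∫ θ, weight t x θ * F θ ∂q0 := by
    intro F hF hFint hFquad
    rw [← integral_const_mul, ← integral_add (hf0_int hF hFint hFquad)
      ((integrable_weight_mul ht x hFint).const_mul κ)]
    refine integral_congr_ae (Filter.Eventually.of_forall fun θ => ?_)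
    simp only
    ring
  have hone : Continuous fun _ : Vec d => (1 : ℝ) := continuous_const
  have hcont : Continuous fun θ : Vec d => θ i := by fun_prop
  have hZ' := hasDerivAt_integral_weight_mul ht x hone (integrable_const _) hquad
  have hM' := hasDerivAt_integral_weight_mul ht x hcont hcoord_int hcoord_quad
  rw [← hκ, hsplit hone (integrable_const _) hquad] at hZ'
  rw [← hκ, hsplit hcont hcoord_int hcoord_quad] at hM'
  have hB := hf0_int hone (integrable_const _) hquad
  have hA := hf0_int hcont hcoord_int hcoord_quad
  simp only [mul_one] at hZ' hB
  have hcov : ∫ θ, (θ i - condMean q0 t x i) * f0 t x θ ∂(condMeasure q0 t x)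
      = ((∫ θ, weight t x θ * (f0 t x θ * θ i) ∂q0)
        - condMean q0 t x i * ∫ θ, weight t x θ * f0 t x θ ∂q0)
          / ∫ θ, weight t x θ ∂q0 := by
    rw [integral_condMeasure q0 ht, smul_eq_mul, ← div_eq_inv_mul, ← integral_const_mul,
      ← integral_sub hA (hB.const_mul _)]
    congr 1
    refine integral_congr_ae (Filter.Eventually.of_forall fun θ => ?_)
    simp only [smul_eq_mul]
    ring
  have hexp : HasDerivAt (fun v : ℝ => Real.exp (-v)) (-Real.exp (-t)) t := by
    simpa using (hasDerivAt_neg t).exp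
  have hexp2 : HasDerivAt (fun v : ℝ => 1 - Real.exp (-2 * v)) (2 * Real.exp (-t) ^ 2) t := by
    refine (((hasDerivAt_id t).const_mul (-2)).exp.const_sub 1).congr_deriv ?_
    simp only [id, exp_neg_two_mul]
    ring
  have hscore := ((hexp.mul (hM'.div hZ' hZ.ne')).sub_const (x i)).div hexp2 hS.ne'
  have heq : (fun u => pd i (fun y => Real.log (ρ u y)) x) =ᶠ[nhds t] fun u =>
      (Real.exp (-u) * ((∫ θ, weight u x θ * θ i ∂q0) / ∫ θ, weight u x θ ∂q0) - x i)
        / (1 - Real.exp (-2 * u)) := by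
    filter_upwards [Ioi_mem_nhds ht] with u hu
    exact pd_log_density_eq hu ((hρsmooth u hu).differentiable (by simp)) (hρpos u hu)
      (hρ u hu) hint1 x i
  refine HasDerivAt.congr_of_eventuallyEq (hscore.congr_deriv ?_) heq
  rw [hcov, condMean_apply q0 ht x hint1 i]
  simp only [Pi.mul_apply, Pi.div_apply]
  rw [exp_neg_two_mul] at hS ⊢
  have hS' := hS.ne'
  have hZ0 := hZ.ne'
  field_simp
  ring

end
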